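/- Let n ≥ 2 and let p' = p/(p−1). Then: (i) if 2 ≤ p < 2(n+3)/(n+1), there exists C > 0 with ‖φ_ν‖_{L^p(ℝⁿ)}‖φ_ν‖_{L^{p'}(ℝⁿ)} ≤ C |ν|^{((n−1)/2)(1/2 − 1/p)} for all ν ∈ ℕ₀ⁿ, ν ≠ 0; (ii) if 2(n+3)/(n+1) < p ≤ 2n/(n−2) (with 2n/(n−2) interpreted as ∞ when n = 2), there exists C > 0 with ‖φ_ν‖_{L^p(ℝⁿ)}‖φ_ν‖_{L^{p'}(ℝⁿ)} ≤ C |ν|^{−1/6 + (2n/3)(1/2 − 1/p)} for all ν ≠ 0; (iii) if 2n/(n−2) ≤ p ≤ ∞, there exists C > 0 with ‖φ_ν‖_{L^p(ℝⁿ)}‖φ_ν‖_{L^{p'}(ℝⁿ)} ≤ C |ν|^{−1/2 + n(1/2 − 1/p)} for all ν ≠ 0. -/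

import Mathlib

open MeasureTheory Filter
open scoped ENNReal

noncomputable section

/-- Physicists' Hermite polynomial `H_k` as a real function:
`H_k(t) = (−1)^k e^{t²} (d/dt)^k e^{−t²}`. -/
def hermitePolyFun (k : ℕ) (t : ℝ) : ℝ :=
  (-1 : ℝ) ^ k * Real.exp (t ^ 2) * iteratedDeriv k (fun s => Real.exp (-s ^ 2)) t

/-- One-dimensional Hermite function `φ_k(t) = (2^k k! √π)^{-1/2} H_k(t) e^{-t²/2}`. -/
def hermiteFun (k : ℕ) (t : ℝ) : ℝ :=
  ((2 : ℝ) ^ k * (Nat.factorial k : ℝ) * Real.sqrt Real.pi) ^ (-(1 : ℝ) / 2) *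
    hermitePolyFun k t * Real.exp (-(t ^ 2) / 2)

/-- Hermite function `φ_ν` on `ℝⁿ`, `φ_ν(x) = ∏ⱼ φ_{νⱼ}(xⱼ)`. -/
def hermiteFunPi {n : ℕ} (ν : Fin n → ℕ) (x : Fin n → ℝ) : ℝ :=
  ∏ j, hermiteFun (ν j) (x j)

/-- Fourier–Hermite coefficient `f̂(φ_ν) = ∫ f(x) φ_ν(x) dx` of a Schwartz function. -/
def hermiteCoeff {n : ℕ} (f : SchwartzMap (Fin n → ℝ) ℂ) (ν : Fin n → ℕ) : ℂ :=
  ∫ x : Fin n → ℝ, f x * (hermiteFunPi ν x : ℂ)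

/-- Pseudo-multiplier associated to the harmonic oscillator:
`T_m f(x) = Σ_ν m(x,ν) f̂(φ_ν) φ_ν(x)`. -/
def pseudoMult {n : ℕ} (m : (Fin n → ℝ) → (Fin n → ℕ) → ℂ)
    (f : SchwartzMap (Fin n → ℝ) ℂ) (x : Fin n → ℝ) : ℂ :=
  ∑' ν : Fin n → ℕ, m x ν * hermiteCoeff f ν * (hermiteFunPi ν x : ℂ)

/-- Inverse Fourier–Hermite transform `𝓕_H⁻¹ u (x) = Σ_ν u(ν) φ_ν(x)`. -/
def fhInv {n : ℕ} (u : (Fin n → ℕ) → ℂ) (x : Fin n → ℝ) : ℂ :=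
  ∑' ν : Fin n → ℕ, u ν * (hermiteFunPi ν x : ℂ)

/-- Euclidean Fourier transform on `ℝⁿ` (modelled as `Fin n → ℝ`). -/
def fourierPi {n : ℕ} (g : (Fin n → ℝ) → ℂ) (x : Fin n → ℝ) : ℂ :=
  ∫ ξ : Fin n → ℝ, Complex.exp (-(2 * Real.pi * (∑ j, x j * ξ j)) * Complex.I) * g ξ

/-- One-dimensional Fourier transform. -/
def fourier1 (g : ℝ → ℂ) (t : ℝ) : ℂ :=
  ∫ τ : ℝ, Complex.exp (-(2 * Real.pi * (t * τ)) * Complex.I) * g τ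

/-- Partial derivative in the `j`-th coordinate. -/
def pderiv1 {n : ℕ} (j : Fin n) (f : (Fin n → ℝ) → ℂ) : (Fin n → ℝ) → ℂ :=
  fun ξ => fderiv ℝ f ξ (Pi.single j 1)

/-- Multi-index partial derivative `∂^α`. -/
def pderivMulti {n : ℕ} (α : Fin n → ℕ) (f : (Fin n → ℝ) → ℂ) : (Fin n → ℝ) → ℂ :=
  (List.finRange n).foldr (fun j g => (pderiv1 j)^[α j] g) f

/-- Forward difference in the `j`-th coordinate. -/
def dDiff {n : ℕ} (j : Fin n) (g : (Fin n → ℕ) → ℂ) : (Fin n → ℕ) → ℂ :=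
  fun ν => g (ν + Pi.single j 1) - g ν

/-- Multi-index forward difference `Δ^α`. -/
def dDiffMulti {n : ℕ} (α : Fin n → ℕ) (g : (Fin n → ℕ) → ℂ) : (Fin n → ℕ) → ℂ :=
  (List.finRange n).foldr (fun j h => (dDiff j)^[α j] h) g

/-- Projection onto the `ℓ`-th Hermite eigenspace: `P_ℓ f = Σ_{|ν|=ℓ} f̂(φ_ν) φ_ν`. -/
def hermiteProj {n : ℕ} (f : SchwartzMap (Fin n → ℝ) ℂ) (ℓ : ℕ) (x : Fin n → ℝ) : ℂ :=
  ∑' ν : Fin n → ℕ, if (∑ j, ν j) = ℓ then hermiteCoeff f ν * (hermiteFunPi ν x : ℂ) else 0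

/-- Spectral pseudo-multiplier `m(x,H) f(x) = Σ_ℓ m(x,ℓ) P_ℓ f(x)`. -/
def spectralPM {n : ℕ} (m : (Fin n → ℝ) → ℝ → ℂ)
    (f : SchwartzMap (Fin n → ℝ) ℂ) (x : Fin n → ℝ) : ℂ :=
  ∑' ℓ : ℕ, m x (ℓ : ℝ) * hermiteProj f ℓ x

/-- Multilinear pseudo-multiplier. -/
def multiPM {n κ : ℕ} (m : (Fin n → ℝ) → (Fin κ → Fin n → ℕ) → ℂ)
    (f : Fin κ → SchwartzMap (Fin n → ℝ) ℂ) (x : Fin n → ℝ) : ℂ :=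
  ∑' ν : Fin κ → Fin n → ℕ,
    m x ν * (∏ j, hermiteCoeff (f j) (ν j)) * ∏ j, (hermiteFunPi (ν j) x : ℂ)

/-- Inverse Fourier–Hermite transform on `ℝ^{nκ}` (modelled as `Fin κ → Fin n → ℝ`). -/
def fhInv2 {n κ : ℕ} (u : (Fin κ → Fin n → ℕ) → ℂ) (z : Fin κ → Fin n → ℝ) : ℂ :=
  ∑' ν : Fin κ → Fin n → ℕ, u ν * ∏ j, (hermiteFunPi (ν j) (z j) : ℂ)

/-- Euclidean Fourier transform on `ℝ^{nκ}` (modelled as `Fin κ → Fin n → ℝ`). -/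
def fourierPi2 {n κ : ℕ} (g : (Fin κ → Fin n → ℝ) → ℂ) (z : Fin κ → Fin n → ℝ) : ℂ :=
  ∫ ξ : Fin κ → Fin n → ℝ,
    Complex.exp (-(2 * Real.pi * (∑ j, ∑ i, z j i * ξ j i)) * Complex.I) * g ξ

/-- A normalised real solution `h` (with derivative `dh`) of `h'' = (x² - L⁴) h` that decays at
infinity together with its derivative. -/
structure IsOscillatorState (h dh : ℝ → ℝ) (L : ℝ) : Prop where
  one_le : 1 ≤ L
  hasDerivAt : ∀ x, HasDerivAt h (dh x) x
  hasDerivAt_deriv : ∀ x, HasDerivAt dh ((x ^ 2 - L ^ 4) * h x) x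
  integrable_sq : Integrable (fun x => h x ^ 2)
  integrable_moment : Integrable (fun x => x ^ 2 * h x ^ 2)
  integral_sq : ∫ x, h x ^ 2 = 1
  integral_moment : ∫ x, x ^ 2 * h x ^ 2 ≤ L ^ 4
  tendsto_atTop : Tendsto h atTop (nhds 0)
  tendsto_deriv_atTop : Tendsto dh atTop (nhds 0)
  tendsto_mul_atTop : Tendsto (fun x => x * h x) atTop (nhds 0)
  tendsto_atBot : Tendsto h atBot (nhds 0)
  tendsto_deriv_atBot : Tendsto dh atBot (nhds 0)
  tendsto_mul_atBot : Tendsto (fun x => x * h x) atBot (nhds 0)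

namespace IsOscillatorState

variable {h dh : ℝ → ℝ} {L : ℝ}

theorem reflect (H : IsOscillatorState h dh L) :
    IsOscillatorState (fun x => h (-x)) (fun x => -dh (-x)) L where
  one_le := H.one_le
  hasDerivAt x := by
    have := (H.hasDerivAt (-x)).comp x (hasDerivAt_neg x)
    simpa [Function.comp_def] using this
  hasDerivAt_deriv x := by
    have := ((H.hasDerivAt_deriv (-x)).comp x (hasDerivAt_neg x)).neg
    refine (this.congr_deriv (by ring)).congr_of_eventuallyEq (Eventually.of_forall fun y => rfl)
  integrable_sq := H.integrable_sq.comp_neg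
  integrable_moment := by simpa using H.integrable_moment.comp_neg
  integral_sq := by
    rw [integral_neg_eq_self (fun x => h x ^ 2)]; exact H.integral_sq
  integral_moment := by
    have := integral_neg_eq_self (fun x => x ^ 2 * h x ^ 2) volume
    simp only [neg_sq] at this
    rw [this]; exact H.integral_moment
  tendsto_atTop := H.tendsto_atBot.comp tendsto_neg_atTop_atBot
  tendsto_deriv_atTop := by
    simpa using (H.tendsto_deriv_atBot.comp tendsto_neg_atTop_atBot).neg
  tendsto_mul_atTop := by
    simpa [Function.comp_def] using (H.tendsto_mul_atBot.comp tendsto_neg_atTop_atBot).neg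
  tendsto_atBot := H.tendsto_atTop.comp tendsto_neg_atBot_atTop
  tendsto_deriv_atBot := by
    simpa using (H.tendsto_deriv_atTop.comp tendsto_neg_atBot_atTop).neg
  tendsto_mul_atBot := by
    simpa [Function.comp_def] using (H.tendsto_mul_atTop.comp tendsto_neg_atBot_atTop).neg

theorem hasDerivAt_energy (H : IsOscillatorState h dh L) (x : ℝ) :
    HasDerivAt (fun x => (L ^ 4 - x ^ 2) * h x ^ 2 + dh x ^ 2) (-(2 * x * h x ^ 2)) x := by
  have h1 := (((hasDerivAt_const x (L ^ 4)).sub (hasDerivAt_pow 2 x)).mul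
    ((H.hasDerivAt x).pow 2)).add ((H.hasDerivAt_deriv x).pow 2)
  refine h1.congr_deriv ?_
  simp only [Pi.sub_apply, Pi.pow_apply]
  push_cast
  ring

theorem tendsto_energy (H : IsOscillatorState h dh L) :
    Tendsto (fun x => (L ^ 4 - x ^ 2) * h x ^ 2 + dh x ^ 2) atTop (nhds 0) := by
  have h1 := (((H.tendsto_atTop.pow 2).const_mul (L ^ 4)).sub (H.tendsto_mul_atTop.pow 2)).add
    (H.tendsto_deriv_atTop.pow 2)
  have e : L ^ 4 * (0 : ℝ) ^ 2 - 0 ^ 2 + 0 ^ 2 = 0 := by ring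
  rw [e] at h1
  exact h1.congr fun x => by ring

theorem energy_nonneg (H : IsOscillatorState h dh L) {x : ℝ} (hx : 0 ≤ x) :
    0 ≤ (L ^ 4 - x ^ 2) * h x ^ 2 + dh x ^ 2 := by
  have anti : AntitoneOn (fun x => (L ^ 4 - x ^ 2) * h x ^ 2 + dh x ^ 2) (Set.Ici 0) := by
    refine antitoneOn_of_hasDerivWithinAt_nonpos (convex_Ici 0)
      (fun x _ => (H.hasDerivAt_energy x).continuousAt.continuousWithinAt)
      (fun x _ => (H.hasDerivAt_energy x).hasDerivWithinAt) ?_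
    intro x hx
    rw [interior_Ici] at hx
    have : 0 < x := hx
    have := mul_nonneg this.le (sq_nonneg (h x))
    linarith
  refine le_of_tendsto H.tendsto_energy ?_
  filter_upwards [eventually_ge_atTop x] with y hy
  exact anti hx (hx.trans hy) hy

/-- The energy at the origin. -/
theorem energy_zero_le (H : IsOscillatorState h dh L) :
    L ^ 4 * h 0 ^ 2 + dh 0 ^ 2 ≤ 2 * L ^ 2 := by
  have hL := H.one_le
  have hL2 : (0 : ℝ) < L ^ 2 := by positivity
  have hb : ∀ x : ℝ, |x| * h x ^ 2 ≤ L ^ 2 / 2 * h x ^ 2 + 1 / (2 * L ^ 2) * (x ^ 2 * h x ^ 2) := by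
    intro x
    have : |x| ≤ L ^ 2 / 2 + 1 / (2 * L ^ 2) * x ^ 2 := by
      rw [← sq_abs x]
      have e : L ^ 2 / 2 + 1 / (2 * L ^ 2) * |x| ^ 2 - |x| = (|x| - L ^ 2) ^ 2 / (2 * L ^ 2) := by
        field_simp
        ring
      have : 0 ≤ (|x| - L ^ 2) ^ 2 / (2 * L ^ 2) := by positivity
      linarith
    nlinarith [mul_le_mul_of_nonneg_right this (sq_nonneg (h x))]
  have hcont : Continuous h := continuous_iff_continuousAt.2 fun x => (H.hasDerivAt x).continuousAt
  have hdom : Integrable (fun x => L ^ 2 / 2 * h x ^ 2 + 1 / (2 * L ^ 2) * (x ^ 2 * h x ^ 2)) :=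
    (H.integrable_sq.const_mul _).add (H.integrable_moment.const_mul _)
  have hmom : Integrable (fun x => |x| * h x ^ 2) := by
    refine hdom.mono' (by fun_prop) (Eventually.of_forall fun x => ?_)
    rw [Real.norm_of_nonneg (by positivity)]
    exact hb x
  have hmom' : Integrable (fun x => -(2 * x * h x ^ 2)) := by
    refine (hmom.const_mul 2).mono (by fun_prop) (Eventually.of_forall fun x => ?_)
    simp [mul_assoc]
  have key := integral_Ioi_of_hasDerivAt_of_tendsto' (a := 0)
    (fun x _ => H.hasDerivAt_energy x) hmom'.integrableOn H.tendsto_energy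
  have e1 : ∫ x in Set.Ioi (0 : ℝ), -(2 * x * h x ^ 2) =
      -(2 * ∫ x in Set.Ioi (0 : ℝ), |x| * h x ^ 2) := by
    rw [← integral_const_mul, ← integral_neg]
    refine setIntegral_congr_fun measurableSet_Ioi fun x hx => ?_
    rw [abs_of_pos (Set.mem_Ioi.1 hx)]
    ring
  have e2 : ∫ x in Set.Ioi (0 : ℝ), |x| * h x ^ 2 ≤ ∫ x, |x| * h x ^ 2 :=
    setIntegral_le_integral hmom (Eventually.of_forall fun x => by positivity)
  have e3 : ∫ x, |x| * h x ^ 2 ≤ L ^ 2 / 2 + 1 / (2 * L ^ 2) * L ^ 4 := by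
    refine (integral_mono hmom hdom hb).trans ?_
    rw [integral_add (H.integrable_sq.const_mul _) (H.integrable_moment.const_mul _),
      integral_const_mul, integral_const_mul, H.integral_sq]
    have := mul_le_mul_of_nonneg_left H.integral_moment (a := 1 / (2 * L ^ 2)) (by positivity)
    linarith
  have e4 : L ^ 2 / 2 + 1 / (2 * L ^ 2) * L ^ 4 = L ^ 2 := by
    field_simp
    ring
  rw [e1] at key
  simp only [ne_eq, OfNat.ofNat_ne_zero, not_false_eq_true, zero_pow, sub_zero] at key
  linarith

/-- Amplitude bound up to the turning point. -/
theorem sq_mul_sqrt_le (H : IsOscillatorState h dh L) {c : ℝ} (hc : 3 ≤ c)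
    (hcL : c ^ 3 = 27 * L ^ 4) {x : ℝ} (hx0 : 0 ≤ x) (hxL : x ≤ L ^ 2) :
    h x ^ 2 * √(L ^ 4 + c - x ^ 2) ≤ 3000 := by
  have hL := H.one_le
  have hP : ∀ y ∈ Set.Icc 0 (L ^ 2), c ≤ L ^ 4 + c - y ^ 2 := by
    intro y hy
    have := pow_le_pow_left₀ hy.1 hy.2 2
    nlinarith
  set a : ℝ → ℝ := fun y => (√(L ^ 4 + c - y ^ 2))⁻¹ with ha
  have hapos : ∀ y ∈ Set.Icc 0 (L ^ 2), 0 < a y := fun y hy => by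
    have := hP y hy
    have : 0 < L ^ 4 + c - y ^ 2 := by linarith
    simp only [ha]; positivity
  have haP : ∀ y ∈ Set.Icc 0 (L ^ 2), a y ^ 2 * (L ^ 4 + c - y ^ 2) = 1 := fun y hy => by
    have := hP y hy
    have h0 : 0 < L ^ 4 + c - y ^ 2 := by linarith
    simp only [ha, inv_pow]
    rw [Real.sq_sqrt h0.le, inv_mul_cancel₀ h0.ne']
  have had : ∀ y ∈ Set.Icc 0 (L ^ 2), HasDerivAt a (y * a y ^ 3) y := fun y hy => by
    have := hP y hy
    have h0 : 0 < L ^ 4 + c - y ^ 2 := by linarith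
    have h1 : HasDerivAt (fun y => L ^ 4 + c - y ^ 2) (-(2 * y)) y := by
      simpa using (hasDerivAt_pow 2 y).const_sub (L ^ 4 + c)
    have h2 := (h1.sqrt h0.ne').inv (Real.sqrt_pos.2 h0).ne'
    refine h2.congr_deriv ?_
    simp only [ha]
    ring
  set I : ℝ → ℝ := fun y => a y * dh y ^ 2 - y * a y ^ 3 * (h y * dh y) +
    (a y * (L ^ 4 - y ^ 2) + (a y ^ 3 + 3 * y ^ 2 * a y ^ 5) / 2) * h y ^ 2 with hI
  have hId : ∀ y ∈ Set.Icc 0 (L ^ 2), HasDerivAt I (y * a y ^ 3 * h y ^ 2 *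
      (9 / 2 * a y ^ 2 + 15 / 2 * y ^ 2 * a y ^ 4 - 2 * c)) y := fun y hy => by
    have d1 := had y hy
    have d2 := H.hasDerivAt y
    have d3 := H.hasDerivAt_deriv y
    have d0 := hasDerivAt_id' y
    have D := ((d1.mul (d3.pow 2)).sub ((d0.mul (d1.pow 3)).mul (d2.mul d3))).add
      (((d1.mul ((d0.pow 2).const_sub (L ^ 4))).add
        (((d1.pow 3).add (((d0.pow 2).const_mul 3).mul (d1.pow 5))).div_const 2)).mul (d2.pow 2))
    refine D.congr_deriv ?_
    have hh := haP y hy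
    simp only [Pi.mul_apply, Pi.pow_apply, Pi.add_apply]
    push_cast
    linear_combination (2 * y * a y * h y ^ 2) * hh
  have hanti : AntitoneOn I (Set.Icc 0 (L ^ 2)) := by
    refine antitoneOn_of_hasDerivWithinAt_nonpos (convex_Icc _ _)
      (fun y hy => (hId y hy).continuousAt.continuousWithinAt)
      (fun y hy => (hId y (interior_subset hy)).hasDerivWithinAt) ?_
    intro y hy
    have hy := interior_subset hy
    have hp := hapos y hy
    refine mul_nonpos_of_nonneg_of_nonpos (by have := hy.1; positivity) ?_
    have hcs : a y ^ 2 * c ≤ 1 := by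
      rw [← haP y hy]
      exact mul_le_mul_of_nonneg_left (hP y hy) (by positivity)
    have h1 : a y ^ 2 ≤ 1 / 3 := by nlinarith [sq_nonneg (a y)]
    have hy2 : y ^ 2 ≤ L ^ 4 := by
      have := pow_le_pow_left₀ hy.1 hy.2 2
      nlinarith
    have h2 : y ^ 2 * a y ^ 4 ≤ c / 27 := by
      calc y ^ 2 * a y ^ 4 ≤ L ^ 4 * a y ^ 4 := by gcongr
        _ = c / 27 * (a y ^ 2 * c) ^ 2 := by
          have : L ^ 4 = c ^ 3 / 27 := by linarith
          rw [this]; ring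
        _ ≤ c / 27 * 1 ^ 2 := by gcongr
        _ = c / 27 := by ring
    linarith
  have hx : x ∈ Set.Icc 0 (L ^ 2) := ⟨hx0, hxL⟩
  have h0 : (0 : ℝ) ∈ Set.Icc 0 (L ^ 2) := ⟨le_rfl, by positivity⟩
  have hle := hanti h0 hx hx0
  have ha0 : a 0 * L ^ 2 ≤ 1 := by
    simp only [ha]
    rw [inv_mul_le_iff₀ (Real.sqrt_pos.2 (by have := hP 0 h0; linarith))]
    rw [mul_one]
    apply Real.le_sqrt_of_sq_le
    nlinarith
  have hI0 : I 0 ≤ 3 := by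
    have hE := H.energy_zero_le
    have e : I 0 = a 0 * (L ^ 4 * h 0 ^ 2 + dh 0 ^ 2) + a 0 ^ 3 / 2 * h 0 ^ 2 := by
      simp only [hI]; ring
    have hp := hapos 0 h0
    have hL2 : 1 ≤ L ^ 2 := one_le_pow₀ hL
    have ha1 : a 0 ≤ 1 := by nlinarith
    have h1 : a 0 * (L ^ 4 * h 0 ^ 2 + dh 0 ^ 2) ≤ 2 := by
      calc _ ≤ a 0 * (2 * L ^ 2) := by gcongr
        _ ≤ 2 := by linarith
    have h2 : a 0 ^ 3 / 2 * h 0 ^ 2 ≤ a 0 * (L ^ 4 * h 0 ^ 2 + dh 0 ^ 2) / 2 := by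
      have h3 : a 0 ^ 3 ≤ a 0 := by nlinarith [sq_nonneg (a 0), mul_pos hp hp]
      have h4 : h 0 ^ 2 ≤ L ^ 4 * h 0 ^ 2 + dh 0 ^ 2 := by
        have hL4 : 1 ≤ L ^ 4 := one_le_pow₀ hL
        nlinarith [sq_nonneg (h 0), sq_nonneg (dh 0)]
      calc _ ≤ a 0 / 2 * (L ^ 4 * h 0 ^ 2 + dh 0 ^ 2) := by gcongr
        _ = _ := by ring
    rw [e]; linarith
  set P := L ^ 4 + c - x ^ 2 with hPdef
  have hcP : c ≤ P := hP x hx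
  have hp := hapos x hx
  have hPa : a x ^ 2 * P = 1 := haP x hx
  have hlow : P / 1000 ≤ P - c + a x ^ 2 / 2 + 5 / 4 * x ^ 2 * a x ^ 4 := by
    have haeq : a x ^ 2 = 1 / P := by
      rw [eq_div_iff (by linarith)]; exact hPa
    have ha4 : a x ^ 4 = 1 / P ^ 2 := by
      rw [show a x ^ 4 = (a x ^ 2) ^ 2 by ring, haeq]; ring
    have hn : 0 ≤ x ^ 2 * a x ^ 4 := by positivity
    have hn2 : 0 ≤ a x ^ 2 := by positivity
    rcases le_or_gt (2 * c) P with h2 | h2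
    · nlinarith
    have hP0 : 0 < P := by linarith
    rcases le_or_gt c 6 with h6 | h6
    · have : 1 / 12 ≤ a x ^ 2 := by
        rw [haeq]
        exact one_div_le_one_div_of_le hP0 (by linarith)
      nlinarith
    · have hx2 : c ^ 3 / 108 ≤ x ^ 2 := by
        have : x ^ 2 = L ^ 4 + c - P := by rw [hPdef]; ring
        have : L ^ 4 = c ^ 3 / 27 := by linarith
        nlinarith [mul_pos (show 0 < c by linarith) (show 0 < c by linarith),
          mul_le_mul_of_nonneg_left (show 36 ≤ c ^ 2 by nlinarith) (show 0 ≤ c by linarith)]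
      have h3 : P ≤ 864 * (x ^ 2 * a x ^ 4) := by
        rw [ha4, mul_one_div, mul_div_assoc', le_div_iff₀ (by positivity)]
        have : P * P ^ 2 ≤ 8 * c ^ 3 := by
          calc P * P ^ 2 = P ^ 3 := by ring
            _ ≤ (2 * c) ^ 3 := by gcongr
            _ = _ := by ring
        linarith
      nlinarith
  have hIx : a x * (P / 1000) * h x ^ 2 ≤ I x := by
    have e : I x = a x * (dh x - x * a x ^ 2 * h x / 2) ^ 2 +
        a x * (P - c + a x ^ 2 / 2 + 5 / 4 * x ^ 2 * a x ^ 4) * h x ^ 2 := by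
      simp only [hI, hPdef]; ring
    have : a x * (P / 1000) * h x ^ 2 ≤
        a x * (P - c + a x ^ 2 / 2 + 5 / 4 * x ^ 2 * a x ^ 4) * h x ^ 2 := by gcongr
    have : 0 ≤ a x * (dh x - x * a x ^ 2 * h x / 2) ^ 2 := by positivity
    linarith
  have hsq : a x * P = √P := by
    have hP0 : 0 < P := by linarith
    change (√P)⁻¹ * P = √P
    rw [inv_mul_eq_div, Real.div_sqrt]
  have : h x ^ 2 * √P = 1000 * (a x * (P / 1000) * h x ^ 2) := by rw [← hsq]; ring
  rw [this]; linarith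

theorem mul_deriv_nonpos (H : IsOscillatorState h dh L) {x : ℝ} (hx : L ^ 2 ≤ x) :
    h x * dh x ≤ 0 := by
  have hL := H.one_le
  have hd : ∀ y, HasDerivAt (fun y => h y * dh y) (dh y ^ 2 + (y ^ 2 - L ^ 4) * h y ^ 2) y :=
    fun y => ((H.hasDerivAt y).mul (H.hasDerivAt_deriv y)).congr_deriv (by ring)
  have mono : MonotoneOn (fun y => h y * dh y) (Set.Ici (L ^ 2)) := by
    refine monotoneOn_of_hasDerivWithinAt_nonneg (convex_Ici _)
      (fun y _ => (hd y).continuousAt.continuousWithinAt) (fun y _ => (hd y).hasDerivWithinAt) ?_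
    intro y hy
    have hy : L ^ 2 ≤ y := interior_subset hy
    have := pow_le_pow_left₀ (by positivity) hy 2
    have : 0 ≤ y ^ 2 - L ^ 4 := by nlinarith
    positivity
  have hlim : Tendsto (fun y => h y * dh y) atTop (nhds 0) := by
    simpa using H.tendsto_atTop.mul H.tendsto_deriv_atTop
  refine ge_of_tendsto hlim ?_
  filter_upwards [eventually_ge_atTop x] with y hy
  exact mono hx (hx.trans hy) hy

theorem antitoneOn_sq (H : IsOscillatorState h dh L) :
    AntitoneOn (fun x => h x ^ 2) (Set.Ici (L ^ 2)) := by
  have hd : ∀ y, HasDerivAt (fun y => h y ^ 2) (2 * (h y * dh y)) y :=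
    fun y => ((H.hasDerivAt y).pow 2).congr_deriv (by push_cast; ring)
  refine antitoneOn_of_hasDerivWithinAt_nonpos (convex_Ici _)
    (fun y _ => (hd y).continuousAt.continuousWithinAt) (fun y _ => (hd y).hasDerivWithinAt) ?_
  intro y hy
  have := H.mul_deriv_nonpos (interior_subset hy : L ^ 2 ≤ y)
  linarith

theorem exists_turning_scale (hL : 1 ≤ L) : ∃ c : ℝ, 3 ≤ c ∧ L ≤ c ∧ c ^ 3 = 27 * L ^ 4 := by
  have hL0 : 0 ≤ L := by linarith
  refine ⟨3 * L ^ (4 / 3 : ℝ), ?_, ?_, ?_⟩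
  · have := Real.one_le_rpow hL (show (0 : ℝ) ≤ 4 / 3 by norm_num)
    linarith
  · have := Real.rpow_le_rpow_of_exponent_le hL (show (1 : ℝ) ≤ 4 / 3 by norm_num)
    rw [Real.rpow_one] at this
    linarith
  · rw [mul_pow, ← Real.rpow_natCast (L ^ (4 / 3 : ℝ)) 3, ← Real.rpow_mul hL0]
    norm_num

theorem pow_four_le_of_nonneg (H : IsOscillatorState h dh L) {x : ℝ} (hx : 0 ≤ x) :
    h x ^ 2 ≤ 3000 ∧ h x ^ 4 ≤ 3000 ^ 2 / L *
      (h x ^ 2 + (Set.Icc (L ^ 2 - 1) (L ^ 2 + 1)).indicator (fun _ => (1 : ℝ)) x) := by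
  have hL := H.one_le
  have hL0 : 0 < L := by linarith
  obtain ⟨c, hc, hLc, hcL⟩ := exists_turning_scale hL
  have inner : ∀ y, 0 ≤ y → y ≤ L ^ 2 → h y ^ 2 * √c ≤ 3000 := by
    intro y hy0 hy
    have h1 := pow_le_pow_left₀ hy0 hy 2
    refine le_trans ?_ (H.sq_mul_sqrt_le hc hcL hy0 hy)
    gcongr
    nlinarith
  have all : h x ^ 2 * √c ≤ 3000 := by
    rcases le_total x (L ^ 2) with h1 | h1
    · exact inner x hx h1
    · refine le_trans ?_ (inner (L ^ 2) (by positivity) le_rfl)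
      have := H.antitoneOn_sq (Set.mem_Ici.2 le_rfl) h1 h1
      exact mul_le_mul_of_nonneg_right this (Real.sqrt_nonneg _)
  have hsc : 1 ≤ √c := Real.one_le_sqrt.2 (by linarith)
  have bdd : h x ^ 2 ≤ 3000 := by nlinarith [sq_nonneg (h x)]
  refine ⟨bdd, ?_⟩
  by_cases hm : x ∈ Set.Icc (L ^ 2 - 1) (L ^ 2 + 1)
  · rw [Set.indicator_of_mem hm, div_mul_eq_mul_div, le_div_iff₀ hL0]
    have h1 : h x ^ 4 * c ≤ 3000 ^ 2 := by
      have := pow_le_pow_left₀ (by positivity) all 2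
      rw [mul_pow, Real.sq_sqrt (by linarith)] at this
      calc h x ^ 4 * c = (h x ^ 2) ^ 2 * c := by ring
        _ ≤ _ := this
    have h2 : h x ^ 4 * L ≤ h x ^ 4 * c := by gcongr
    nlinarith [sq_nonneg (h x)]
  · rw [Set.indicator_of_notMem hm, add_zero]
    suffices hs : h x ^ 2 * L ≤ 3000 by
      rw [div_mul_eq_mul_div, le_div_iff₀ hL0]
      calc h x ^ 4 * L = h x ^ 2 * (h x ^ 2 * L) := by ring
        _ ≤ h x ^ 2 * 3000 := by gcongr
        _ ≤ _ := by nlinarith [sq_nonneg (h x)]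
    rcases lt_or_ge x (L ^ 2 - 1) with h1 | h1
    · refine le_trans ?_ (H.sq_mul_sqrt_le hc hcL hx (by linarith))
      gcongr
      refine Real.le_sqrt_of_sq_le ?_
      nlinarith
    · have h2 : L ^ 2 + 1 < x := by
        by_contra h3
        exact hm ⟨h1, not_lt.1 h3⟩
      set b := L ^ 2 + 1 / 2 with hb
      have hd : ∀ y, HasDerivAt (fun y => h y ^ 2 + 2 * L * h x ^ 2 * y)
          (2 * (h y * dh y) + 2 * L * h x ^ 2) y := fun y =>
        (((H.hasDerivAt y).pow 2).add ((hasDerivAt_id' y).const_mul _)).congr_deriv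
          (by push_cast; ring)
      have anti : AntitoneOn (fun y => h y ^ 2 + 2 * L * h x ^ 2 * y) (Set.Icc b x) := by
        refine antitoneOn_of_hasDerivWithinAt_nonpos (convex_Icc _ _)
          (fun y _ => (hd y).continuousAt.continuousWithinAt)
          (fun y _ => (hd y).hasDerivWithinAt) ?_
        intro y hy
        have hy : y ∈ Set.Icc b x := interior_subset hy
        have hyL : L ^ 2 ≤ y := by linarith [hy.1]
        have hn := H.mul_deriv_nonpos hyL
        have hE := H.energy_nonneg (x := y) (by nlinarith)
        have hw : h x ^ 2 ≤ h y ^ 2 := H.antitoneOn_sq hyL (hyL.trans hy.2) hy.2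
        have hsq : L ^ 2 ≤ y ^ 2 - L ^ 4 := by
          have := pow_le_pow_left₀ (by positivity) hy.1 2
          rw [hb] at this
          nlinarith
        have hdy : L ^ 2 * h y ^ 2 ≤ dh y ^ 2 := by
          nlinarith [mul_le_mul_of_nonneg_right hsq (sq_nonneg (h y))]
        have : L * h y ^ 2 ≤ -(h y * dh y) := by
          refine abs_le_of_sq_le_sq' ?_ (by linarith) |>.2
          calc (L * h y ^ 2) ^ 2 = h y ^ 2 * (L ^ 2 * h y ^ 2) := by ring
            _ ≤ h y ^ 2 * dh y ^ 2 := by gcongr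
            _ = _ := by ring
        nlinarith [mul_le_mul_of_nonneg_left hw hL0.le]
      have hbx : b ≤ x := by linarith
      have h3 := anti (Set.left_mem_Icc.2 hbx) (Set.right_mem_Icc.2 hbx) hbx
      simp only at h3
      have h4 : h b ^ 2 ≤ h (L ^ 2) ^ 2 := H.antitoneOn_sq (Set.mem_Ici.2 le_rfl)
        (Set.mem_Ici.2 (by linarith)) (by linarith)
      have h5 := inner (L ^ 2) (by positivity) le_rfl
      have h6 : h (L ^ 2) ^ 2 ≤ 3000 := by nlinarith [sq_nonneg (h (L ^ 2))]
      have h7 : L * h x ^ 2 * (1 / 2) ≤ L * h x ^ 2 * (x - b) := by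
        gcongr
        linarith
      nlinarith [sq_nonneg (h x)]

theorem sq_le (H : IsOscillatorState h dh L) (x : ℝ) : h x ^ 2 ≤ 3000 := by
  rcases le_total 0 x with hx | hx
  · exact (H.pow_four_le_of_nonneg hx).1
  · simpa using (H.reflect.pow_four_le_of_nonneg (neg_nonneg.2 hx)).1

theorem pow_four_le (H : IsOscillatorState h dh L) (x : ℝ) :
    h x ^ 4 ≤ 3000 ^ 2 / L *
      (h x ^ 2 + (Set.Icc (L ^ 2 - 1) (L ^ 2 + 1)).indicator (fun _ => (1 : ℝ)) x +
        (Set.Icc (L ^ 2 - 1) (L ^ 2 + 1)).indicator (fun _ => (1 : ℝ)) (-x)) := by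
  have hL := H.one_le
  have hn : ∀ y, 0 ≤ (Set.Icc (L ^ 2 - 1) (L ^ 2 + 1)).indicator (fun _ => (1 : ℝ)) y :=
    fun y => Set.indicator_nonneg (fun _ _ => zero_le_one) y
  rcases le_total 0 x with hx | hx
  · exact (H.pow_four_le_of_nonneg hx).2.trans
      (mul_le_mul_of_nonneg_left (by linarith [hn (-x)]) (by positivity))
  · have := (H.reflect.pow_four_le_of_nonneg (neg_nonneg.2 hx)).2
    simp only [neg_neg] at this
    exact this.trans (mul_le_mul_of_nonneg_left (by linarith [hn x]) (by positivity))

theorem continuous (H : IsOscillatorState h dh L) : Continuous h :=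
  continuous_iff_continuousAt.2 fun x => (H.hasDerivAt x).continuousAt

theorem integral_pow_four_le (H : IsOscillatorState h dh L) :
    Integrable (fun x => h x ^ 4) ∧ ∫ x, h x ^ 4 ≤ 5 * 3000 ^ 2 / L := by
  have hL := H.one_le
  have hcont := H.continuous
  have i1 : Integrable ((Set.Icc (L ^ 2 - 1) (L ^ 2 + 1)).indicator (fun _ => (1 : ℝ))) :=
    (integrable_indicator_iff measurableSet_Icc).2 (integrableOn_const (by simp))
  have i12 := H.integrable_sq.add i1
  have i := (i12.add i1.comp_neg).const_mul (3000 ^ 2 / L)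
  refine ⟨i.mono' (by fun_prop) (Eventually.of_forall fun x => ?_), ?_⟩
  · rw [Real.norm_of_nonneg (by positivity)]
    exact H.pow_four_le x
  · refine (integral_mono_of_nonneg (Eventually.of_forall fun x => by positivity) i
      (Eventually.of_forall H.pow_four_le)).trans (le_of_eq ?_)
    have e : ∫ x, (Set.Icc (L ^ 2 - 1) (L ^ 2 + 1)).indicator (fun _ => (1 : ℝ)) x = 2 := by
      rw [integral_indicator measurableSet_Icc]
      simp [Measure.real]
      norm_num
    rw [integral_const_mul]
    rw [integral_add' i12 i1.comp_neg, integral_add' H.integrable_sq i1,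
      integral_neg_eq_self ((Set.Icc (L ^ 2 - 1) (L ^ 2 + 1)).indicator (fun _ => (1 : ℝ))),
      H.integral_sq, e]
    ring

theorem integral_abs_le (H : IsOscillatorState h dh L) :
    Integrable (fun x => |h x|) ∧ ∫ x, |h x| ≤ 3 * L := by
  have hL := H.one_le
  have hL0 : 0 < L := by linarith
  have hcont := H.continuous
  have i0 : Integrable (fun x : ℝ => (1 + (x / L ^ 2) ^ 2)⁻¹) :=
    integrable_inv_one_add_sq.comp_div (by positivity)
  have i : Integrable (fun x => L / 2 * h x ^ 2 + 1 / (2 * L ^ 3) * (x ^ 2 * h x ^ 2) +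
      1 / (2 * L) * (1 + (x / L ^ 2) ^ 2)⁻¹) :=
    ((H.integrable_sq.const_mul _).add (H.integrable_moment.const_mul _)).add (i0.const_mul _)
  have hb : ∀ x, |h x| ≤ L / 2 * h x ^ 2 + 1 / (2 * L ^ 3) * (x ^ 2 * h x ^ 2) +
      1 / (2 * L) * (1 + (x / L ^ 2) ^ 2)⁻¹ := by
    intro x
    have hu : 0 < 1 + (x / L ^ 2) ^ 2 := by positivity
    have e : L / 2 * h x ^ 2 + 1 / (2 * L ^ 3) * (x ^ 2 * h x ^ 2) +
        1 / (2 * L) * (1 + (x / L ^ 2) ^ 2)⁻¹ - |h x| =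
        (L * (1 + (x / L ^ 2) ^ 2) * |h x| - 1) ^ 2 / (2 * L * (1 + (x / L ^ 2) ^ 2)) := by
      rw [← sq_abs (h x)]
      have e1 : 1 / (2 * L ^ 3) * (x ^ 2 * |h x| ^ 2) =
        L / 2 * ((1 + (x / L ^ 2) ^ 2) - 1) * |h x| ^ 2 := by
        field_simp
        ring
      rw [e1]
      generalize 1 + (x / L ^ 2) ^ 2 = u at hu ⊢
      field_simp
      ring
    have : 0 ≤ (L * (1 + (x / L ^ 2) ^ 2) * |h x| - 1) ^ 2 / (2 * L * (1 + (x / L ^ 2) ^ 2)) := by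
      positivity
    linarith
  refine ⟨i.mono' (by fun_prop) (Eventually.of_forall fun x => ?_), ?_⟩
  · rw [Real.norm_of_nonneg (by positivity)]
    exact hb x
  refine (integral_mono_of_nonneg (Eventually.of_forall fun x => by positivity) i
      (Eventually.of_forall hb)).trans ?_
  have i2 : Integrable (fun x => L / 2 * h x ^ 2 + 1 / (2 * L ^ 3) * (x ^ 2 * h x ^ 2)) :=
    (H.integrable_sq.const_mul _).add (H.integrable_moment.const_mul _)
  rw [integral_add i2 (i0.const_mul _), integral_add (H.integrable_sq.const_mul _)
    (H.integrable_moment.const_mul _), integral_const_mul, integral_const_mul,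
    integral_const_mul, H.integral_sq,
    Measure.integral_comp_div (fun x : ℝ => (1 + x ^ 2)⁻¹), integral_univ_inv_one_add_sq]
  have h1 : 1 / (2 * L ^ 3) * ∫ x, x ^ 2 * h x ^ 2 ≤ 1 / (2 * L ^ 3) * L ^ 4 :=
    mul_le_mul_of_nonneg_left H.integral_moment (by positivity)
  have h2 : 1 / (2 * L ^ 3) * L ^ 4 = L / 2 := by field_simp
  have h3 : 1 / (2 * L) * (|L ^ 2| • Real.pi) = L * Real.pi / 2 := by
    rw [abs_of_pos (by positivity), smul_eq_mul]
    field_simp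
  rw [h3]
  nlinarith [Real.pi_le_four]

end IsOscillatorState

section PolynomialGaussian

open Polynomial

theorem integrable_polynomial_mul_gaussian (p : ℝ[X]) {b : ℝ} (hb : 0 < b) :
    Integrable (fun x => p.eval x * Real.exp (-b * x ^ 2)) := by
  induction p using Polynomial.induction_on' with
  | add p q hp hq =>
    simp only [eval_add, add_mul]
    exact hp.add hq
  | monomial m a =>
    have h := (integrable_rpow_mul_exp_neg_mul_sq hb
      (show (-1 : ℝ) < (m : ℝ) by have := m.cast_nonneg (α := ℝ); linarith)).const_mul a
    simpa [eval_monomial, mul_assoc] using h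

theorem hasDerivAt_polynomial_mul_gaussian (p : ℝ[X]) (b x : ℝ) :
    HasDerivAt (fun x => p.eval x * Real.exp (-b * x ^ 2))
      ((derivative p - C (2 * b) * X * p).eval x * Real.exp (-b * x ^ 2)) x := by
  have h := (p.hasDerivAt x).mul ((hasDerivAt_pow 2 x).const_mul (-b)).exp
  refine h.congr_deriv ?_
  simp
  ring

theorem tendsto_polynomial_mul_gaussian_atTop (p : ℝ[X]) {b : ℝ} (hb : 0 < b) :
    Tendsto (fun x => p.eval x * Real.exp (-b * x ^ 2)) atTop (nhds 0) :=
  tendsto_zero_of_hasDerivAt_of_integrableOn_Ioi (a := 0)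
    (fun x _ => hasDerivAt_polynomial_mul_gaussian p b x)
    (integrable_polynomial_mul_gaussian _ hb).integrableOn
    (integrable_polynomial_mul_gaussian _ hb).integrableOn

theorem tendsto_polynomial_mul_gaussian_atBot (p : ℝ[X]) {b : ℝ} (hb : 0 < b) :
    Tendsto (fun x => p.eval x * Real.exp (-b * x ^ 2)) atBot (nhds 0) :=
  tendsto_zero_of_hasDerivAt_of_integrableOn_Iic (a := 0)
    (fun x _ => hasDerivAt_polynomial_mul_gaussian p b x)
    (integrable_polynomial_mul_gaussian _ hb).integrableOn
    (integrable_polynomial_mul_gaussian _ hb).integrableOn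

theorem integral_deriv_polynomial_mul_gaussian (p : ℝ[X]) {b : ℝ} (hb : 0 < b) :
    ∫ x, (derivative p - C (2 * b) * X * p).eval x * Real.exp (-b * x ^ 2) = 0 :=
  integral_eq_zero_of_hasDerivAt_of_integrable
    (fun x => hasDerivAt_polynomial_mul_gaussian p b x)
    (integrable_polynomial_mul_gaussian _ hb) (integrable_polynomial_mul_gaussian _ hb)

/-- The physicists' Hermite polynomials, by their first-order recursion. -/
def physHermite : ℕ → ℝ[X]
  | 0 => 1
  | k + 1 => C 2 * X * physHermite k - derivative (physHermite k)

theorem iteratedDeriv_gaussian (k : ℕ) :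
    iteratedDeriv k (fun s : ℝ => Real.exp (-s ^ 2)) =
      fun t => (-1) ^ k * ((physHermite k).eval t * Real.exp (-1 * t ^ 2)) := by
  induction k with
  | zero => simp [physHermite]
  | succ k ih =>
    rw [iteratedDeriv_succ, ih]
    funext t
    rw [((hasDerivAt_polynomial_mul_gaussian (physHermite k) 1 t).const_mul ((-1) ^ k)).deriv]
    simp [physHermite]
    ring

theorem hermitePolyFun_eq (k : ℕ) (t : ℝ) : hermitePolyFun k t = (physHermite k).eval t := by
  have h1 : Real.exp (t ^ 2) * Real.exp (-1 * t ^ 2) = 1 := by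
    rw [← Real.exp_add]; simp
  have h2 : ((-1 : ℝ) ^ k) * (-1) ^ k = 1 := by rw [← mul_pow]; simp
  rw [hermitePolyFun, iteratedDeriv_gaussian]
  calc _ = ((-1 : ℝ) ^ k * (-1) ^ k) * (Real.exp (t ^ 2) * Real.exp (-1 * t ^ 2)) *
        (physHermite k).eval t := by ring
    _ = _ := by rw [h1, h2]; ring

theorem derivative_physHermite_succ (k : ℕ) :
    derivative (physHermite (k + 1)) = C (2 * ((k : ℝ) + 1)) * physHermite k := by
  induction k with
  | zero => simp [physHermite]
  | succ k ih =>
    rw [physHermite, derivative_sub, ih]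
    simp only [derivative_mul, derivative_C, derivative_X, ih]
    simp only [physHermite, C_mul, C_add, C_1, Nat.cast_add, Nat.cast_one]
    ring

theorem physHermite_ode (k : ℕ) :
    derivative (derivative (physHermite k)) =
      C 2 * X * derivative (physHermite k) - C (2 * (k : ℝ)) * physHermite k := by
  have h := derivative_physHermite_succ k
  rw [physHermite] at h
  simp only [derivative_sub, derivative_mul, derivative_C, derivative_X] at h
  simp only [C_mul, C_add, C_1] at h ⊢
  linear_combination -h

theorem integral_physHermite_sq (k : ℕ) :
    ∫ x, (physHermite k ^ 2).eval x * Real.exp (-1 * x ^ 2) = 2 ^ k * k.factorial * √Real.pi := by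
  induction k with
  | zero => simpa [physHermite] using integral_gaussian 1
  | succ k ih =>
    have h := integral_deriv_polynomial_mul_gaussian (physHermite k * physHermite (k + 1))
      one_pos
    have e : derivative (physHermite k * physHermite (k + 1)) -
        C (2 * 1) * X * (physHermite k * physHermite (k + 1)) =
        C (2 * ((k : ℝ) + 1)) * physHermite k ^ 2 - physHermite (k + 1) ^ 2 := by
      rw [derivative_mul, derivative_physHermite_succ, physHermite]
      simp only [mul_one]
      ring
    rw [e] at h
    simp only [eval_sub, sub_mul] at h
    rw [integral_sub (integrable_polynomial_mul_gaussian _ one_pos)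
      (integrable_polynomial_mul_gaussian _ one_pos)] at h
    have e2 : ∫ x, (C (2 * ((k : ℝ) + 1)) * physHermite k ^ 2).eval x * Real.exp (-1 * x ^ 2) =
        2 * ((k : ℝ) + 1) * ∫ x, (physHermite k ^ 2).eval x * Real.exp (-1 * x ^ 2) := by
      rw [← integral_const_mul]
      simp only [eval_mul, eval_C, mul_assoc]
    rw [e2, ih] at h
    rw [← sub_eq_zero.1 h, Nat.factorial_succ]
    push_cast
    ring

/-- The normalising constant of the `k`-th Hermite function. -/
def hermiteNorm (k : ℕ) : ℝ :=
  ((2 : ℝ) ^ k * (Nat.factorial k : ℝ) * Real.sqrt Real.pi) ^ (-(1 : ℝ) / 2)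

theorem hermiteNorm_sq (k : ℕ) :
    hermiteNorm k ^ 2 * (2 ^ k * k.factorial * √Real.pi) = 1 := by
  have h : (0 : ℝ) < 2 ^ k * k.factorial * √Real.pi := by positivity
  rw [hermiteNorm, ← Real.rpow_natCast, ← Real.rpow_mul h.le]
  norm_num
  rw [Real.rpow_neg_one, inv_mul_cancel₀ h.ne']

theorem hermiteFun_eq (k : ℕ) (t : ℝ) :
    hermiteFun k t = hermiteNorm k * ((physHermite k).eval t * Real.exp (-(1 / 2) * t ^ 2)) := by
  rw [hermiteFun, hermitePolyFun_eq, hermiteNorm,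
    show -(t ^ 2) / 2 = -(1 / 2) * t ^ 2 by ring, mul_assoc]

/-- The derivative of the `k`-th Hermite function. -/
def hermiteFunDeriv (k : ℕ) (t : ℝ) : ℝ :=
  hermiteNorm k * ((derivative (physHermite k) - C (2 * (1 / 2)) * X * physHermite k).eval t *
    Real.exp (-(1 / 2) * t ^ 2))

/-- The fourth root of the eigenvalue `2k + 1`. -/
def hermiteScale (k : ℕ) : ℝ := (2 * (k : ℝ) + 1) ^ (1 / 4 : ℝ)

theorem hermiteScale_pow_four (k : ℕ) : hermiteScale k ^ 4 = 2 * (k : ℝ) + 1 := by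
  rw [hermiteScale, ← Real.rpow_natCast, ← Real.rpow_mul (by positivity)]
  norm_num

theorem one_le_hermiteScale (k : ℕ) : 1 ≤ hermiteScale k :=
  Real.one_le_rpow (by have := k.cast_nonneg (α := ℝ); linarith) (by norm_num)

theorem mul_gaussian_sq (c y t : ℝ) :
    (c * (y * Real.exp (-(1 / 2) * t ^ 2))) ^ 2 = c ^ 2 * (y ^ 2 * Real.exp (-1 * t ^ 2)) := by
  have : Real.exp (-1 * t ^ 2) = Real.exp (-(1 / 2) * t ^ 2) ^ 2 := by
    rw [← Real.exp_nat_mul]; congr 1; push_cast; ring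
  rw [this]; ring

theorem isOscillatorState_hermiteFun (k : ℕ) :
    IsOscillatorState (hermiteFun k) (hermiteFunDeriv k) (hermiteScale k) := by
  have hb : (0 : ℝ) < 1 / 2 := by norm_num
  have hfun : hermiteFun k = fun t => hermiteNorm k *
    ((physHermite k).eval t * Real.exp (-(1 / 2) * t ^ 2)) := funext (hermiteFun_eq k)
  have hsq : ∀ x, hermiteFun k x ^ 2 =
      hermiteNorm k ^ 2 * ((physHermite k ^ 2).eval x * Real.exp (-1 * x ^ 2)) := fun x => by
    rw [hermiteFun_eq, mul_gaussian_sq, eval_pow]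
  have hmom : ∀ x, x ^ 2 * hermiteFun k x ^ 2 =
      hermiteNorm k ^ 2 * (((X * physHermite k) ^ 2).eval x * Real.exp (-1 * x ^ 2)) := fun x => by
    rw [hsq]; simp only [eval_pow, eval_mul, eval_X]; ring
  have hmul : (fun x => x * hermiteFun k x) = fun x => hermiteNorm k *
      ((X * physHermite k).eval x * Real.exp (-(1 / 2) * x ^ 2)) := by
    funext x; rw [hermiteFun_eq]; simp only [eval_mul, eval_X]; ring
  have hdsq : ∀ x, hermiteFunDeriv k x ^ 2 = hermiteNorm k ^ 2 *
      (((derivative (physHermite k) - C (2 * (1 / 2)) * X * physHermite k) ^ 2).eval x *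
        Real.exp (-1 * x ^ 2)) := fun x => by
    rw [hermiteFunDeriv, mul_gaussian_sq, eval_pow]
  have d1 : ∀ x, HasDerivAt (hermiteFun k) (hermiteFunDeriv k x) x := fun x => by
    rw [hfun]
    exact (hasDerivAt_polynomial_mul_gaussian _ _ x).const_mul _
  have d2 : ∀ x, HasDerivAt (hermiteFunDeriv k)
      ((x ^ 2 - hermiteScale k ^ 4) * hermiteFun k x) x := fun x => by
    refine ((hasDerivAt_polynomial_mul_gaussian
      (derivative (physHermite k) - C (2 * (1 / 2)) * X * physHermite k)
      (1 / 2) x).const_mul (hermiteNorm k)).congr_deriv ?_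
    rw [hermiteFun_eq, hermiteScale_pow_four]
    have ho := physHermite_ode k
    have e : derivative (derivative (physHermite k) - C (2 * (1 / 2)) * X * physHermite k) -
        C (2 * (1 / 2)) * X * (derivative (physHermite k) - C (2 * (1 / 2)) * X * physHermite k) =
        (X ^ 2 - C (2 * (k : ℝ) + 1)) * physHermite k := by
      rw [derivative_sub, ho]
      simp only [show (2 * (1 / 2) : ℝ) = 1 by norm_num, C_1, one_mul, derivative_mul,
        derivative_X, C_add]
      rw [show (C 2 : ℝ[X]) = 2 from rfl]
      ring
    rw [e]
    simp only [eval_mul, eval_sub, eval_pow, eval_X, eval_C]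
    ring
  have i1 : Integrable (fun x => hermiteFun k x ^ 2) := by
    simp only [hsq]
    exact (integrable_polynomial_mul_gaussian _ one_pos).const_mul _
  have i2 : Integrable (fun x => x ^ 2 * hermiteFun k x ^ 2) := by
    simp only [hmom]
    exact (integrable_polynomial_mul_gaussian _ one_pos).const_mul _
  have i3 : Integrable (fun x => hermiteFunDeriv k x ^ 2) := by
    simp only [hdsq]
    exact (integrable_polynomial_mul_gaussian _ one_pos).const_mul _
  have m0 : ∫ x, hermiteFun k x ^ 2 = 1 := by
    simp only [hsq]
    rw [integral_const_mul, integral_physHermite_sq, hermiteNorm_sq]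
  have hcont : Continuous (hermiteFun k) :=
    continuous_iff_continuousAt.2 fun x => (d1 x).continuousAt
  have hdcont : Continuous (hermiteFunDeriv k) :=
    continuous_iff_continuousAt.2 fun x => (d2 x).continuousAt
  have m1 : ∫ x, x ^ 2 * hermiteFun k x ^ 2 ≤ hermiteScale k ^ 4 := by
    have i4 : Integrable (fun x => hermiteFunDeriv k x ^ 2 + x ^ 2 * hermiteFun k x ^ 2 -
        hermiteScale k ^ 4 * hermiteFun k x ^ 2) := (i3.add i2).sub (i1.const_mul _)
    have i5 : Integrable (fun x => hermiteFun k x * hermiteFunDeriv k x) := by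
      refine (i1.add i3).mono' (by fun_prop) (Eventually.of_forall fun x => ?_)
      rw [Real.norm_eq_abs, abs_le]
      constructor <;> simp only [Pi.add_apply] <;>
        nlinarith [sq_nonneg (hermiteFun k x + hermiteFunDeriv k x),
          sq_nonneg (hermiteFun k x - hermiteFunDeriv k x), sq_nonneg (hermiteFun k x),
          sq_nonneg (hermiteFunDeriv k x)]
    have h := integral_eq_zero_of_hasDerivAt_of_integrable
      (fun x => ((d1 x).mul (d2 x)).congr_deriv (show _ = hermiteFunDeriv k x ^ 2 +
        x ^ 2 * hermiteFun k x ^ 2 - hermiteScale k ^ 4 * hermiteFun k x ^ 2 by ring)) i4 i5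
    have i6 : Integrable (fun x => hermiteFunDeriv k x ^ 2 + x ^ 2 * hermiteFun k x ^ 2) :=
      i3.add i2
    rw [integral_sub i6 (i1.const_mul _), integral_add i3 i2, integral_const_mul, m0] at h
    have : 0 ≤ ∫ x, hermiteFunDeriv k x ^ 2 := integral_nonneg fun x => sq_nonneg _
    linarith
  have t1 := fun p : ℝ[X] => (tendsto_polynomial_mul_gaussian_atTop p hb).const_mul (hermiteNorm k)
  have t2 := fun p : ℝ[X] => (tendsto_polynomial_mul_gaussian_atBot p hb).const_mul (hermiteNorm k)
  simp only [mul_zero] at t1 t2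
  exact
    { one_le := one_le_hermiteScale k
      hasDerivAt := d1
      hasDerivAt_deriv := d2
      integrable_sq := i1
      integrable_moment := i2
      integral_sq := m0
      integral_moment := m1
      tendsto_atTop := by rw [hfun]; exact t1 _
      tendsto_deriv_atTop := t1 _
      tendsto_mul_atTop := by rw [hmul]; exact t1 _
      tendsto_atBot := by rw [hfun]; exact t2 _
      tendsto_deriv_atBot := t2 _
      tendsto_mul_atBot := by rw [hmul]; exact t2 _ }

end PolynomialGaussian

theorem rpow_le_add_of_le_of_le {t A a b r : ℝ} (ht : 0 ≤ t) (hA : 0 < A) (hr : 0 < r)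
    (ha : a ≤ r) (hb : r ≤ b) : t ^ r ≤ A ^ (r - a) * t ^ a + A ^ (r - b) * t ^ b := by
  rcases ht.eq_or_lt with rfl | ht
  · rw [Real.zero_rpow hr.ne']
    have h1 := Real.rpow_nonneg (le_refl (0 : ℝ)) a
    have h2 := Real.rpow_nonneg (le_refl (0 : ℝ)) b
    positivity
  rcases le_total t A with h | h
  · have h1 : t ^ r ≤ A ^ (r - a) * t ^ a := by
      calc t ^ r = t ^ (r - a) * t ^ a := by rw [← Real.rpow_add ht]; ring_nf
        _ ≤ _ := by gcongr
    have : 0 ≤ A ^ (r - b) * t ^ b := by positivity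
    linarith
  · have h1 : t ^ r ≤ A ^ (r - b) * t ^ b := by
      calc t ^ r = t ^ (r - b) * t ^ b := by rw [← Real.rpow_add ht]; ring_nf
        _ ≤ _ := mul_le_mul_of_nonneg_right
          (Real.rpow_le_rpow_of_nonpos hA h (by linarith)) (by positivity)
    have : 0 ≤ A ^ (r - a) * t ^ a := by positivity
    linarith

namespace IsOscillatorState

variable {h dh : ℝ → ℝ} {L : ℝ}

theorem integral_rpow_le_of_le_two (H : IsOscillatorState h dh L) {r : ℝ} (h1 : 1 ≤ r)
    (h2 : r ≤ 2) : Integrable (fun x => |h x| ^ r) ∧ ∫ x, |h x| ^ r ≤ 4 * L ^ (2 - r) := by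
  have hL0 : 0 < L := by have := H.one_le; linarith
  have hcont := H.continuous
  obtain ⟨i1, m1⟩ := H.integral_abs_le
  have i : Integrable (fun x => L⁻¹ ^ (r - 1) * |h x| + L⁻¹ ^ (r - 2) * h x ^ 2) :=
    (i1.const_mul _).add (H.integrable_sq.const_mul _)
  have hb : ∀ x, |h x| ^ r ≤ L⁻¹ ^ (r - 1) * |h x| + L⁻¹ ^ (r - 2) * h x ^ 2 := fun x => by
    have := rpow_le_add_of_le_of_le (abs_nonneg (h x)) (inv_pos.2 hL0)
      (by linarith : 0 < r) h1 h2
    rwa [Real.rpow_one, Real.rpow_two, sq_abs] at this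
  refine ⟨i.mono' (hcont.abs.rpow_const fun _ => Or.inr (by linarith)).aestronglyMeasurable
    (Eventually.of_forall fun x => ?_), ?_⟩
  · rw [Real.norm_of_nonneg (by positivity)]
    exact hb x
  refine (integral_mono_of_nonneg (Eventually.of_forall fun x => by positivity) i
    (Eventually.of_forall hb)).trans ?_
  rw [integral_add (i1.const_mul _) (H.integrable_sq.const_mul _), integral_const_mul,
    integral_const_mul, H.integral_sq, Real.inv_rpow hL0.le, Real.inv_rpow hL0.le,
    ← Real.rpow_neg hL0.le, ← Real.rpow_neg hL0.le]
  have e : L ^ (2 - r) = L ^ (-(r - 1)) * L := by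
    rw [← Real.rpow_add_one hL0.ne']; ring_nf
  have h3 : L ^ (-(r - 1)) * ∫ x, |h x| ≤ L ^ (-(r - 1)) * (3 * L) := by gcongr
  rw [show -(r - 2) = 2 - r by ring]
  linarith

theorem integral_rpow_le_of_le_four (H : IsOscillatorState h dh L) {r : ℝ} (h1 : 2 ≤ r)
    (h2 : r ≤ 4) : Integrable (fun x => |h x| ^ r) ∧
      ∫ x, |h x| ^ r ≤ (1 + 5 * 3000 ^ 2) * L ^ (-(r - 2) / 2) := by
  have hL0 : 0 < L := by have := H.one_le; linarith
  have hcont := H.continuous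
  obtain ⟨i1, m1⟩ := H.integral_pow_four_le
  set A : ℝ := L ^ (-(1 / 2) : ℝ) with hA
  have hA0 : 0 < A := by positivity
  have i : Integrable (fun x => A ^ (r - 2) * h x ^ 2 + A ^ (r - 4) * h x ^ 4) :=
    (H.integrable_sq.const_mul _).add (i1.const_mul _)
  have hb : ∀ x, |h x| ^ r ≤ A ^ (r - 2) * h x ^ 2 + A ^ (r - 4) * h x ^ 4 := fun x => by
    have := rpow_le_add_of_le_of_le (abs_nonneg (h x)) hA0 (by linarith : 0 < r) h1 h2
    rwa [Real.rpow_two, sq_abs, show (4 : ℝ) = ((4 : ℕ) : ℝ) by norm_num,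
      Real.rpow_natCast |h x|, Even.pow_abs (by decide)] at this
  refine ⟨i.mono' (hcont.abs.rpow_const fun _ => Or.inr (by linarith)).aestronglyMeasurable
    (Eventually.of_forall fun x => ?_), ?_⟩
  · rw [Real.norm_of_nonneg (by positivity)]
    exact hb x
  refine (integral_mono_of_nonneg (Eventually.of_forall fun x => by positivity) i
    (Eventually.of_forall hb)).trans ?_
  rw [integral_add (H.integrable_sq.const_mul _) (i1.const_mul _), integral_const_mul,
    integral_const_mul, H.integral_sq, hA, ← Real.rpow_mul hL0.le, ← Real.rpow_mul hL0.le]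
  have e : L ^ (-(1 / 2) * (r - 4)) = L ^ (-(r - 2) / 2) * L := by
    rw [← Real.rpow_add_one hL0.ne']; ring_nf
  have h3 : L ^ (-(r - 2) / 2) * L * ∫ x, h x ^ 4 ≤
      L ^ (-(r - 2) / 2) * L * (5 * 3000 ^ 2 / L) := by gcongr
  have h4 : L ^ (-(r - 2) / 2) * L * (5 * 3000 ^ 2 / L) =
      L ^ (-(r - 2) / 2) * (5 * 3000 ^ 2) := by field_simp
  rw [e, show -(1 / 2) * (r - 2) = -(r - 2) / 2 by ring]
  linarith

theorem abs_le (H : IsOscillatorState h dh L) (x : ℝ) : |h x| ≤ 60 :=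
  abs_le_of_sq_le_sq (by have := H.sq_le x; linarith) (by norm_num)

theorem integral_rpow_le_of_four_le (H : IsOscillatorState h dh L) {r : ℝ} (h1 : 4 ≤ r) :
    Integrable (fun x => |h x| ^ r) ∧
      ∫ x, |h x| ^ r ≤ 60 ^ (r - 4) * (5 * 3000 ^ 2) * L ^ (-1 : ℝ) := by
  have hL0 : 0 < L := by have := H.one_le; linarith
  have hcont := H.continuous
  obtain ⟨i1, m1⟩ := H.integral_pow_four_le
  have i : Integrable (fun x => (60 : ℝ) ^ (r - 4) * h x ^ 4) := i1.const_mul _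
  have hb : ∀ x, |h x| ^ r ≤ (60 : ℝ) ^ (r - 4) * h x ^ 4 := fun x => by
    have e : |h x| ^ r = |h x| ^ (r - 4) * h x ^ 4 := by
      rw [← Even.pow_abs (n := 4) (by decide), ← Real.rpow_natCast |h x|,
        ← Real.rpow_add' (abs_nonneg _) (by push_cast; linarith)]
      push_cast
      ring_nf
    rw [e]
    exact mul_le_mul_of_nonneg_right
      (Real.rpow_le_rpow (abs_nonneg _) (H.abs_le x) (by linarith)) (by positivity)
  refine ⟨i.mono' (hcont.abs.rpow_const fun _ => Or.inr (by linarith)).aestronglyMeasurable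
    (Eventually.of_forall fun x => ?_), ?_⟩
  · rw [Real.norm_of_nonneg (by positivity)]
    exact hb x
  refine (integral_mono_of_nonneg (Eventually.of_forall fun x => by positivity) i
    (Eventually.of_forall hb)).trans ?_
  rw [integral_const_mul, Real.rpow_neg_one, mul_assoc]
  gcongr
  exact m1

end IsOscillatorState

theorem eLpNorm_hermiteFunPi_le_of_integral_le {p : ℝ≥0∞} (hp0 : p ≠ 0) (hp : p ≠ ⊤) {B g : ℝ}
    (hB : 0 < B) (hb : ∀ k, Integrable (fun x => |hermiteFun k x| ^ p.toReal) ∧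
      ∫ x, |hermiteFun k x| ^ p.toReal ≤ B * hermiteScale k ^ g) {n : ℕ} (ν : Fin n → ℕ) :
    eLpNorm (hermiteFunPi ν) p volume ≤
      ENNReal.ofReal (∏ j, B ^ p.toReal⁻¹ * hermiteScale (ν j) ^ (g * p.toReal⁻¹)) := by
  have hr : 0 < p.toReal := ENNReal.toReal_pos hp0 hp
  have hcont : Continuous (hermiteFunPi ν) := by
    unfold hermiteFunPi
    have := fun k => (isOscillatorState_hermiteFun k).continuous
    fun_prop
  have he : (fun x => ‖hermiteFunPi ν x‖ ^ p.toReal) =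
      fun x : Fin n → ℝ => ∏ j, |hermiteFun (ν j) (x j)| ^ p.toReal := by
    funext x
    rw [hermiteFunPi, Real.norm_eq_abs, Finset.abs_prod,
      Real.finsetProd_rpow _ _ fun _ _ => abs_nonneg _]
  have hi : Integrable (fun x => ‖hermiteFunPi ν x‖ ^ p.toReal) := by
    rw [he]
    exact Integrable.fintype_prod (f := fun j y => |hermiteFun (ν j) y| ^ p.toReal)
      fun j => (hb (ν j)).1
  have hm : MemLp (hermiteFunPi ν) p volume :=
    (integrable_norm_rpow_iff hcont.aestronglyMeasurable hp0 hp).1 hi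
  rw [hm.eLpNorm_eq_integral_rpow_norm hp0 hp, he,
    integral_fintype_prod_volume_eq_prod (fun j y => |hermiteFun (ν j) y| ^ p.toReal)]
  refine ENNReal.ofReal_le_ofReal ?_
  have hI : ∀ j, 0 ≤ ∫ y, |hermiteFun (ν j) y| ^ p.toReal := fun j =>
    integral_nonneg fun y => by positivity
  have hS : ∀ k, 0 < hermiteScale k := fun k => zero_lt_one.trans_le (one_le_hermiteScale k)
  rw [← Real.finsetProd_rpow _ _ fun j _ => hI j]
  refine Finset.prod_le_prod (fun j _ => Real.rpow_nonneg (hI j) _) fun j _ => ?_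
  have := hS (ν j)
  rw [Real.rpow_mul this.le, ← Real.mul_rpow hB.le (by positivity)]
  exact Real.rpow_le_rpow (hI j) (hb (ν j)).2 (by positivity)

theorem exists_eLpNorm_hermiteFunPi_le_of_le_two {q : ℝ≥0∞} (h1 : 1 ≤ q) (h2 : q ≤ 2) :
    ∃ B > (0 : ℝ), ∀ {n : ℕ} (ν : Fin n → ℕ), eLpNorm (hermiteFunPi ν) q volume ≤
      ENNReal.ofReal (∏ j, B * hermiteScale (ν j) ^ (2 / q.toReal - 1)) := by
  have hq0 : q ≠ 0 := (zero_lt_one.trans_le h1).ne'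
  have hq : q ≠ ⊤ := ne_top_of_le_ne_top (by simp) h2
  have hr : 0 < q.toReal := ENNReal.toReal_pos hq0 hq
  refine ⟨4 ^ q.toReal⁻¹, by positivity, fun {n} ν => ?_⟩
  have e : 2 / q.toReal - 1 = (2 - q.toReal) * q.toReal⁻¹ := by field_simp
  rw [e]
  refine eLpNorm_hermiteFunPi_le_of_integral_le hq0 hq (by norm_num) (fun k =>
    (isOscillatorState_hermiteFun k).integral_rpow_le_of_le_two ?_ ?_) ν
  · simpa using ENNReal.toReal_mono hq h1
  · simpa using ENNReal.toReal_mono (by simp) h2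

theorem exists_eLpNorm_hermiteFunPi_le_of_le_four {p : ℝ≥0∞} (h1 : 2 ≤ p) (h2 : p ≤ 4) :
    ∃ B > (0 : ℝ), ∀ {n : ℕ} (ν : Fin n → ℕ), eLpNorm (hermiteFunPi ν) p volume ≤
      ENNReal.ofReal (∏ j, B * hermiteScale (ν j) ^ (1 / p.toReal - 1 / 2)) := by
  have hp0 : p ≠ 0 := (zero_lt_two.trans_le h1).ne'
  have hp : p ≠ ⊤ := ne_top_of_le_ne_top (by simp) h2
  have hr : 0 < p.toReal := ENNReal.toReal_pos hp0 hp
  refine ⟨(1 + 5 * 3000 ^ 2) ^ p.toReal⁻¹, by positivity, fun {n} ν => ?_⟩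
  have e : 1 / p.toReal - 1 / 2 = -(p.toReal - 2) / 2 * p.toReal⁻¹ := by field_simp; ring
  rw [e]
  refine eLpNorm_hermiteFunPi_le_of_integral_le hp0 hp (by norm_num) (fun k =>
    (isOscillatorState_hermiteFun k).integral_rpow_le_of_le_four ?_ ?_) ν
  · simpa using ENNReal.toReal_mono hp h1
  · simpa using ENNReal.toReal_mono (by simp) h2

theorem exists_eLpNorm_hermiteFunPi_le_of_four_le {p : ℝ≥0∞} (h1 : 4 ≤ p) :
    ∃ B > (0 : ℝ), ∀ {n : ℕ} (ν : Fin n → ℕ), eLpNorm (hermiteFunPi ν) p volume ≤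
      ENNReal.ofReal (∏ j, B * hermiteScale (ν j) ^ (-(1 / p.toReal))) := by
  rcases eq_or_ne p ⊤ with rfl | hp
  · refine ⟨60, by norm_num, fun {n} ν => ?_⟩
    rw [eLpNorm_exponent_top]
    refine eLpNormEssSup_le_of_ae_bound (Eventually.of_forall fun x => ?_)
    rw [hermiteFunPi, Real.norm_eq_abs, Finset.abs_prod]
    simp only [ENNReal.toReal_top, div_zero, neg_zero, Real.rpow_zero, mul_one]
    exact Finset.prod_le_prod (fun _ _ => abs_nonneg _)
      fun j _ => (isOscillatorState_hermiteFun (ν j)).abs_le (x j)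
  have hp0 : p ≠ 0 := (lt_of_lt_of_le (by norm_num) h1).ne'
  have hr : 0 < p.toReal := ENNReal.toReal_pos hp0 hp
  refine ⟨(60 ^ (p.toReal - 4) * (5 * 3000 ^ 2)) ^ p.toReal⁻¹, by positivity, fun {n} ν => ?_⟩
  have e : -(1 / p.toReal) = -1 * p.toReal⁻¹ := by ring
  rw [e]
  refine eLpNorm_hermiteFunPi_le_of_integral_le hp0 hp (by positivity) (fun k =>
    (isOscillatorState_hermiteFun k).integral_rpow_le_of_four_le ?_) ν
  simpa using ENNReal.toReal_mono hp h1

theorem exists_le_rpow_of_le_prod_hermiteScale {n : ℕ} {F : (Fin n → ℕ) → ℝ≥0∞} {B e E : ℝ}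
    (hB : 0 < B) (he : 0 ≤ e) (hE : n * e / 4 ≤ E)
    (hF : ∀ ν, F ν ≤ ENNReal.ofReal (∏ j, B * hermiteScale (ν j) ^ e)) :
    ∃ C > (0 : ℝ), ∀ ν : Fin n → ℕ, ν ≠ 0 →
      F ν ≤ ENNReal.ofReal (C * ((∑ j, ν j : ℕ) : ℝ) ^ E) := by
  refine ⟨B ^ n * 3 ^ (n * e / 4), by positivity, fun ν hν => (hF ν).trans ?_⟩
  refine ENNReal.ofReal_le_ofReal ?_
  set N : ℝ := ((∑ j, ν j : ℕ) : ℝ) with hN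
  have hle : ∀ j, ν j ≤ ∑ j, ν j := fun j =>
    Finset.single_le_sum (f := ν) (fun _ _ => Nat.zero_le _) (Finset.mem_univ j)
  have hN1 : 1 ≤ N := by
    obtain ⟨j, hj⟩ := Function.ne_iff.1 hν
    have h1 : 1 ≤ ν j := Nat.one_le_iff_ne_zero.2 hj
    rw [hN]
    exact_mod_cast h1.trans (hle j)
  have hj : ∀ j, B * hermiteScale (ν j) ^ e ≤ B * (3 * N) ^ (e / 4) := fun j => by
    have h1 : (ν j : ℝ) ≤ N := by rw [hN]; exact_mod_cast hle j
    rw [hermiteScale, ← Real.rpow_mul (by positivity), show 1 / 4 * e = e / 4 by ring]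
    gcongr
    linarith
  have hS : ∀ k, 0 < hermiteScale k := fun k => zero_lt_one.trans_le (one_le_hermiteScale k)
  calc ∏ j, B * hermiteScale (ν j) ^ e ≤ ∏ _j : Fin n, B * (3 * N) ^ (e / 4) :=
        Finset.prod_le_prod (fun j _ => by have := hS (ν j); positivity) fun j _ => hj j
    _ = B ^ n * (3 ^ (n * e / 4) * N ^ (n * e / 4)) := by
        rw [Finset.prod_const, Finset.card_univ, Fintype.card_fin, mul_pow,
          ← Real.rpow_mul_natCast (by positivity), ← Real.mul_rpow (by norm_num) (by positivity)]
        ring_nf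
    _ ≤ B ^ n * (3 ^ (n * e / 4) * N ^ E) := by
        gcongr
    _ = _ := by ring

theorem exists_eLpNorm_mul_eLpNorm_hermiteFunPi_le {n : ℕ} {p q : ℝ≥0∞} (hpq : 1 / p + 1 / q = 1)
    (hp : 2 ≤ p) {E : ℝ} (h4 : p ≤ 4 → n * (1 / 2 - 1 / p.toReal) / 4 ≤ E)
    (h4' : 4 ≤ p → n * (3 * (1 / 2 - 1 / p.toReal) - 1 / 2) / 4 ≤ E) :
    ∃ C > (0 : ℝ), ∀ ν : Fin n → ℕ, ν ≠ 0 →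
      eLpNorm (hermiteFunPi ν) p volume * eLpNorm (hermiteFunPi ν) q volume ≤
        ENNReal.ofReal (C * ((∑ j, ν j : ℕ) : ℝ) ^ E) := by
  simp only [one_div] at hpq
  have hpi : p⁻¹ ≤ 2⁻¹ := ENNReal.inv_le_inv.2 hp
  have hq1 : 1 ≤ q := by
    rw [← ENNReal.inv_le_inv, inv_one, ← hpq]
    exact le_add_self
  have hq2 : q ≤ 2 := by
    rw [← ENNReal.inv_le_inv]
    have h := ENNReal.inv_two_add_inv_two
    rw [← hpq] at h
    by_contra hlt
    have := ENNReal.add_lt_add_of_le_of_lt (ne_top_of_le_ne_top (by simp) hpi) hpi (not_le.1 hlt)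
    exact this.ne h.symm
  have hx : 1 / q.toReal = 1 - 1 / p.toReal := by
    have h := congrArg ENNReal.toReal hpq
    rw [ENNReal.toReal_add (ne_top_of_le_ne_top (by simp) hpi)
      (ENNReal.inv_ne_top.2 (zero_lt_one.trans_le hq1).ne'), ENNReal.toReal_inv,
      ENNReal.toReal_inv, ENNReal.toReal_one] at h
    rw [one_div, one_div]
    linarith
  have hx2 : 1 / p.toReal ≤ 1 / 2 := by
    have h := ENNReal.toReal_mono (by simp) hpi
    simpa using h
  obtain ⟨B₂, hB₂, hq⟩ := exists_eLpNorm_hermiteFunPi_le_of_le_two hq1 hq2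
  have hS : ∀ k, 0 < hermiteScale k := fun k => zero_lt_one.trans_le (one_le_hermiteScale k)
  have comb : ∀ {B₁ g : ℝ}, 0 < B₁ → (∀ ν : Fin n → ℕ, eLpNorm (hermiteFunPi ν) p volume ≤
      ENNReal.ofReal (∏ j, B₁ * hermiteScale (ν j) ^ g)) → ∀ ν : Fin n → ℕ,
      eLpNorm (hermiteFunPi ν) p volume * eLpNorm (hermiteFunPi ν) q volume ≤
        ENNReal.ofReal (∏ j, (B₁ * B₂) * hermiteScale (ν j) ^ (g + (2 / q.toReal - 1))) := by
    intro B₁ g hB₁ h ν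
    refine (mul_le_mul' (h ν) (hq ν)).trans (le_of_eq ?_)
    rw [← ENNReal.ofReal_mul (Finset.prod_nonneg fun j _ => by have := hS (ν j); positivity),
      ← Finset.prod_mul_distrib]
    congr 1
    refine Finset.prod_congr rfl fun j _ => ?_
    rw [Real.rpow_add (hS (ν j))]
    ring
  have hq' : 2 / q.toReal - 1 = 1 - 2 * (1 / p.toReal) := by
    rw [show 2 / q.toReal = 2 * (1 / q.toReal) by ring, hx]; ring
  rcases le_total p 4 with h | h
  · obtain ⟨B₁, hB₁, hb⟩ := exists_eLpNorm_hermiteFunPi_le_of_le_four hp h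
    refine exists_le_rpow_of_le_prod_hermiteScale (mul_pos hB₁ hB₂) ?_ ?_ (comb hB₁ hb)
    · rw [hq']; linarith
    · rw [hq']
      refine le_trans (le_of_eq ?_) (h4 h)
      ring
  · obtain ⟨B₁, hB₁, hb⟩ := exists_eLpNorm_hermiteFunPi_le_of_four_le h
    refine exists_le_rpow_of_le_prod_hermiteScale (mul_pos hB₁ hB₂) ?_ ?_ (comb hB₁ hb)
    · rw [hq']
      have h' : 1 / p.toReal ≤ 1 / 4 := by
        have := ENNReal.toReal_mono (by simp) (ENNReal.inv_le_inv.2 h)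
        simpa using this
      linarith
    · rw [hq']
      refine le_trans (le_of_eq ?_) (h4' h)
      ring

theorem one_div_toReal_le_of_ofReal_le {p : ℝ≥0∞} {a : ℝ} (ha : 0 < a)
    (h : ENNReal.ofReal a ≤ p) : 1 / p.toReal ≤ 1 / a := by
  rcases eq_or_ne p ⊤ with rfl | hp
  · simp [ha.le]
  · exact one_div_le_one_div_of_le ha ((ENNReal.ofReal_le_iff_le_toReal hp).1 h)

theorem one_div_le_one_div_toReal {p : ℝ≥0∞} {a : ℝ} (ha : 0 < a) (hp : p ≠ 0)
    (h : p ≤ ENNReal.ofReal a) : 1 / a ≤ 1 / p.toReal :=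
  one_div_le_one_div_of_le (ENNReal.toReal_pos hp (ne_top_of_le_ne_top ENNReal.ofReal_ne_top h))
    (ENNReal.toReal_le_of_le_ofReal ha.le h)

theorem stmt1 (n : ℕ) (hn : 2 ≤ n) (p q : ℝ≥0∞) (hpq : 1 / p + 1 / q = 1) :
    ((2 ≤ p ∧ p < ENNReal.ofReal (2 * ((n : ℝ) + 3) / ((n : ℝ) + 1))) →
      ∃ C > (0 : ℝ), ∀ ν : Fin n → ℕ, ν ≠ 0 →
        eLpNorm (hermiteFunPi ν) p volume * eLpNorm (hermiteFunPi ν) q volume ≤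
          ENNReal.ofReal (C * (((∑ j, ν j : ℕ) : ℝ)) ^
            ((((n : ℝ) - 1) / 2) * (1 / 2 - 1 / p.toReal)))) ∧
    ((ENNReal.ofReal (2 * ((n : ℝ) + 3) / ((n : ℝ) + 1)) < p ∧
        p ≤ (if n = 2 then (⊤ : ℝ≥0∞) else ENNReal.ofReal (2 * (n : ℝ) / ((n : ℝ) - 2)))) →
      ∃ C > (0 : ℝ), ∀ ν : Fin n → ℕ, ν ≠ 0 →
        eLpNorm (hermiteFunPi ν) p volume * eLpNorm (hermiteFunPi ν) q volume ≤
          ENNReal.ofReal (C * (((∑ j, ν j : ℕ) : ℝ)) ^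
            (-(1 : ℝ) / 6 + (2 * (n : ℝ) / 3) * (1 / 2 - 1 / p.toReal)))) ∧
    (((if n = 2 then (⊤ : ℝ≥0∞) else ENNReal.ofReal (2 * (n : ℝ) / ((n : ℝ) - 2))) ≤ p) →
      ∃ C > (0 : ℝ), ∀ ν : Fin n → ℕ, ν ≠ 0 →
        eLpNorm (hermiteFunPi ν) p volume * eLpNorm (hermiteFunPi ν) q volume ≤
          ENNReal.ofReal (C * (((∑ j, ν j : ℕ) : ℝ)) ^
            (-(1 : ℝ) / 2 + (n : ℝ) * (1 / 2 - 1 / p.toReal)))) := by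
  have hn' : (2 : ℝ) ≤ n := by exact_mod_cast hn
  have h3 : (0 : ℝ) < (n : ℝ) + 3 := by linarith
  have ha : 0 < 2 * ((n : ℝ) + 3) / ((n : ℝ) + 1) := by positivity
  have hinv : 1 / (2 * ((n : ℝ) + 3) / ((n : ℝ) + 1)) = 1 / 2 - 1 / ((n : ℝ) + 3) := by
    field_simp
    ring
  have h35 : 1 / ((n : ℝ) + 3) ≤ 1 / 5 := one_div_le_one_div_of_le (by norm_num) (by linarith)
  have hn3 : 2 / 5 ≤ (n : ℝ) * (1 / ((n : ℝ) + 3)) := by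
    rw [mul_one_div, div_le_div_iff₀ (by norm_num) h3]
    linarith
  have le2 : 2 ≤ p → 1 / p.toReal ≤ 1 / 2 := fun h =>
    one_div_toReal_le_of_ofReal_le two_pos (by simpa using h)
  have le4 : 4 ≤ p → 1 / p.toReal ≤ 1 / 4 := fun h =>
    one_div_toReal_le_of_ofReal_le four_pos (by simpa using h)
  have hp0 : 0 ≤ 1 / p.toReal := by positivity
  refine ⟨?_, ?_, ?_⟩
  · rintro ⟨hp2, hp⟩
    have hx := one_div_le_one_div_toReal ha (zero_lt_two.trans_le hp2).ne' hp.le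
    rw [hinv] at hx
    have hx2 := le2 hp2
    refine exists_eLpNorm_mul_eLpNorm_hermiteFunPi_le hpq hp2 (fun _ => ?_) fun h => ?_
    · nlinarith
    · have := le4 h
      linarith
  · rintro ⟨hp, -⟩
    have hx := one_div_toReal_le_of_ofReal_le ha hp.le
    rw [hinv] at hx
    have hp2 : 2 ≤ p := by
      refine le_trans ?_ hp.le
      rw [← ENNReal.ofReal_ofNat 2]
      refine ENNReal.ofReal_le_ofReal ?_
      rw [le_div_iff₀ (by positivity)]
      linarith
    refine exists_eLpNorm_mul_eLpNorm_hermiteFunPi_le hpq hp2 (fun _ => ?_) fun h => ?_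
    · nlinarith
    · nlinarith
  · intro hp
    obtain ⟨hp2, hs⟩ : 2 ≤ p ∧ 1 ≤ (n : ℝ) * (1 / 2 - 1 / p.toReal) := by
      split_ifs at hp with h2
      · rw [top_le_iff.1 hp, h2]
        simp
      · have hn3 : (3 : ℝ) ≤ n := by exact_mod_cast (by omega : 3 ≤ n)
        have hd : (0 : ℝ) < (n : ℝ) - 2 := by linarith
        have hb : 0 < 2 * (n : ℝ) / ((n : ℝ) - 2) := by positivity
        constructor
        · refine le_trans ?_ hp
          rw [← ENNReal.ofReal_ofNat 2]
          refine ENNReal.ofReal_le_ofReal ?_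
          rw [le_div_iff₀ hd]
          linarith
        · have hx := one_div_toReal_le_of_ofReal_le hb hp
          have e : (n : ℝ) * (1 / 2 - 1 / (2 * (n : ℝ) / ((n : ℝ) - 2))) = 1 := by
            field_simp
            ring
          have h := mul_le_mul_of_nonneg_left (sub_le_sub_left hx (1 / 2)) (by linarith : 0 ≤ (n : ℝ))
          rwa [e] at h
    refine exists_eLpNorm_mul_eLpNorm_hermiteFunPi_le hpq hp2 (fun _ => ?_) fun h => ?_
    · linarith
    · linarith
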